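/- Let Ω ⊆ ℝ^d be a bounded open set with smooth boundary, T > 0, ε > 0 and δ > 0. Let f = (f₁,…,f_d) with each f_j ∈ C²(ℝ) and f_j′ bounded, let B ∈ C¹(ℝ) be bounded with B ≥ 0, let A > 0, and let u₀ ∈ C_c^∞(Ω) with ‖u₀‖_{L^∞(Ω)} ≤ A. If u is a classical solution of the regularized viscosity problem with flux f, viscosity coefficient B + δ, parameter ε and data u₀, then ε Σ_{j=1}^d ∫_{Ω_T} B(u(x,t)) |∂_{x_j} u(x,t)|² dx dt ≤ (1/2) ∫_Ω u₀(x)² dx ≤ (1/2) A² vol(Ω). -/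

import Mathlib

open MeasureTheory Set

noncomputable section

/-- The spatial partial derivative of `v` in the `j`-th coordinate direction. -/
def pderiv' {d : ℕ} (v : (Fin d → ℝ) → ℝ) (j : Fin d) (x : Fin d → ℝ) : ℝ :=
  fderiv ℝ v x (Pi.single j 1)

/-- A classical solution of the regularized viscosity problem
`∂ₜ u + Σⱼ ∂ⱼ(fⱼ(u)) = ε Σⱼ ∂ⱼ((B(u)+δ) ∂ⱼ u)` on `Ω × (0,T)`, with homogeneous
Dirichlet boundary condition on `∂Ω × (0,T)` and initial data `u₀`. -/
structure IsClassicalSolution {d : ℕ} (Ω : Set (Fin d → ℝ)) (T ε δ : ℝ)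
    (f : Fin d → ℝ → ℝ) (B : ℝ → ℝ) (u₀ : (Fin d → ℝ) → ℝ)
    (u : (Fin d → ℝ) → ℝ → ℝ) : Prop where
  cont : ContinuousOn (fun p : (Fin d → ℝ) × ℝ => u p.1 p.2) (closure Ω ×ˢ Set.Icc 0 T)
  diff_t : ∀ x ∈ Ω, ∀ t ∈ Set.Ioo 0 T, DifferentiableAt ℝ (u x) t
  diff_x : ∀ x ∈ Ω, ∀ t ∈ Set.Ioo 0 T, DifferentiableAt ℝ (fun y => u y t) x
  diff_xx : ∀ j, ∀ x ∈ Ω, ∀ t ∈ Set.Ioo 0 T,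
      DifferentiableAt ℝ (fun y => pderiv' (fun z => u z t) j y) x
  cont_dt : ContinuousOn (fun p : (Fin d → ℝ) × ℝ => deriv (u p.1) p.2) (Ω ×ˢ Set.Ioo 0 T)
  cont_dx : ∀ j, ContinuousOn
      (fun p : (Fin d → ℝ) × ℝ => pderiv' (fun y => u y p.2) j p.1) (Ω ×ˢ Set.Ioo 0 T)
  cont_dxx : ∀ i j, ContinuousOn
      (fun p : (Fin d → ℝ) × ℝ => pderiv' (pderiv' (fun y => u y p.2) j) i p.1)
      (Ω ×ˢ Set.Ioo 0 T)
  pde : ∀ x ∈ Ω, ∀ t ∈ Set.Ioo 0 T,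
      deriv (u x) t + ∑ j, pderiv' (fun y => f j (u y t)) j x
        = ε * ∑ j, pderiv' (fun y => (B (u y t) + δ) * pderiv' (fun z => u z t) j y) j x
  bc : ∀ x ∈ frontier Ω, ∀ t ∈ Set.Ioo 0 T, u x t = 0
  ic : ∀ x ∈ Ω, u x 0 = u₀ x

open Filter Topology

/-- The second antiderivative of `θ` that vanishes to first order at `0`. -/
def secondPrimitive (θ : ℝ → ℝ) (s : ℝ) : ℝ := ∫ r in (0 : ℝ)..s, ∫ q in (0 : ℝ)..r, θ q

lemma hasDerivAt_primitive {θ : ℝ → ℝ} (hθ : Continuous θ) (s : ℝ) :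
    HasDerivAt (fun r => ∫ q in (0 : ℝ)..r, θ q) (θ s) s :=
  hθ.integral_hasStrictDerivAt 0 s |>.hasDerivAt

lemma continuous_primitive_of_continuous {θ : ℝ → ℝ} (hθ : Continuous θ) :
    Continuous (fun r => ∫ q in (0 : ℝ)..r, θ q) :=
  continuous_iff_continuousAt.2 fun s => (hasDerivAt_primitive hθ s).continuousAt

lemma hasDerivAt_secondPrimitive {θ : ℝ → ℝ} (hθ : Continuous θ) (s : ℝ) :
    HasDerivAt (secondPrimitive θ) (∫ q in (0 : ℝ)..s, θ q) s :=
  hasDerivAt_primitive (continuous_primitive_of_continuous hθ) s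

lemma secondPrimitive_nonneg {θ : ℝ → ℝ} (hθ : ∀ s, 0 ≤ θ s) (s : ℝ) :
    0 ≤ secondPrimitive θ s := by
  unfold secondPrimitive
  rcases le_total 0 s with hs | hs
  · exact intervalIntegral.integral_nonneg hs fun r hr =>
      intervalIntegral.integral_nonneg hr.1 fun q _ => hθ q
  · rw [intervalIntegral.integral_symm, ← intervalIntegral.integral_neg]
    refine intervalIntegral.integral_nonneg hs fun r hr => ?_
    rw [intervalIntegral.integral_symm, neg_neg]
    exact intervalIntegral.integral_nonneg hr.2 fun q _ => hθ q

lemma secondPrimitive_one_sub {θ : ℝ → ℝ} (hθ : Continuous θ) (s : ℝ) :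
    secondPrimitive (fun q => 1 - θ q) s = s ^ 2 / 2 - secondPrimitive θ s := by
  have h (r : ℝ) : ∫ q in (0 : ℝ)..r, (1 - θ q) = r - ∫ q in (0 : ℝ)..r, θ q := by
    rw [intervalIntegral.integral_sub (by simp) (hθ.intervalIntegrable _ _)]
    simp
  unfold secondPrimitive
  simp_rw [h]
  rw [intervalIntegral.integral_sub (continuous_id'.intervalIntegrable _ _)
    ((continuous_primitive_of_continuous hθ).intervalIntegrable _ _)]
  simp

/-- A primitive based at `0` vanishes as long as the integrand does. -/
lemma primitive_eq_zero_of_abs_le {θ : ℝ → ℝ} {η : ℝ} (h : ∀ q, |q| ≤ η → θ q = 0) {s : ℝ}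
    (hs : |s| ≤ η) : ∫ q in (0 : ℝ)..s, θ q = 0 := by
  refine intervalIntegral.integral_zero_ae (.of_forall fun q hq => h q ?_)
  have hη : 0 ≤ η := (abs_nonneg s).trans hs
  rw [abs_le] at hs ⊢
  rcases le_total 0 s with h0 | h0
  · rw [uIoc_of_le h0] at hq
    exact ⟨by linarith [hq.1], hq.2.trans hs.2⟩
  · rw [uIoc_of_ge h0] at hq
    exact ⟨hs.1.trans hq.1.le, by linarith [hq.2]⟩

/-- `s ↦ s` is approximated by a `C¹` nondecreasing function `g` vanishing on `[-η, η]`, with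
derivative `θ` equal to `1` off `(-2η, 2η)`, whose primitive `G` satisfies `0 ≤ G s ≤ s² / 2`. -/
lemma exists_truncation {η : ℝ} (hη : 0 < η) : ∃ θ g G : ℝ → ℝ, Continuous θ ∧
    (∀ s, HasDerivAt g (θ s) s) ∧ (∀ s, HasDerivAt G (g s) s) ∧ (∀ s, 0 ≤ θ s) ∧
    (∀ s, 2 * η ≤ |s| → θ s = 1) ∧ (∀ s, |s| ≤ η → g s = 0) ∧ (∀ s, 0 ≤ G s) ∧
    (∀ s, G s ≤ s ^ 2 / 2) := by
  let θ : ℝ → ℝ := fun s => min 1 (max 0 (|s| / η - 1))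
  have hθ : Continuous θ := by fun_prop
  have hθ0 (s : ℝ) : 0 ≤ θ s := le_min zero_le_one (le_max_left _ _)
  have hθ1 (s : ℝ) : θ s ≤ 1 := min_le_left _ _
  refine ⟨θ, _, secondPrimitive θ, hθ, hasDerivAt_primitive hθ, hasDerivAt_secondPrimitive hθ,
    hθ0, fun s hs => ?_, fun s hs => primitive_eq_zero_of_abs_le (fun q hq => ?_) hs,
    secondPrimitive_nonneg hθ0, fun s => ?_⟩
  · refine min_eq_left (le_max_of_le_right ?_)
    rw [le_sub_iff_add_le, le_div_iff₀ hη]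
    linarith
  · have : |q| / η - 1 ≤ 0 := by rw [sub_nonpos, div_le_one hη]; exact hq
    simp [θ, max_eq_left this]
  · have := secondPrimitive_nonneg (fun q => sub_nonneg.2 (hθ1 q)) s
    rw [secondPrimitive_one_sub hθ] at this
    linarith

/-- The integral of a directional derivative of a function that vanishes off a compact set `K`
is zero. -/
lemma setIntegral_pderiv'_eq_zero {d : ℕ} {Ω K : Set (Fin d → ℝ)} (hΩ : IsOpen Ω)
    (hK : IsCompact K) (hKΩ : K ⊆ Ω) {w : (Fin d → ℝ) → ℝ} (j : Fin d)
    (hw : ∀ x ∈ Ω, DifferentiableAt ℝ w x) (hw' : ContinuousOn (pderiv' w j) K)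
    (hw0 : ∀ x ∈ Ω, x ∉ K → w x = 0) : ∫ x in K, pderiv' w j x = 0 := by
  have hd (x : Fin d → ℝ) : HasLineDerivAt ℝ (K.indicator w) (K.indicator (pderiv' w j) x) x
      (Pi.single j 1) := by
    by_cases hx : x ∈ K
    · rw [indicator_of_mem hx]
      refine HasFDerivAt.hasLineDerivAt (((hw x (hKΩ hx)).hasFDerivAt).congr_of_eventuallyEq ?_) _
      filter_upwards [hΩ.mem_nhds (hKΩ hx)] with y hy
      by_cases hyK : y ∈ K
      · simp [hyK]
      · simp [hyK, hw0 y hy hyK]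
    · rw [indicator_of_notMem hx]
      have : K.indicator w =ᶠ[𝓝 x] fun _ => 0 := by
        filter_upwards [hK.isClosed.isOpen_compl.mem_nhds hx] with y hy
        exact indicator_of_notMem hy _
      simpa using ((hasFDerivAt_const (0 : ℝ) x).congr_of_eventuallyEq this).hasLineDerivAt
        (Pi.single j 1)
  have hi : Integrable (K.indicator w) := by
    rw [integrable_indicator_iff hK.measurableSet]
    exact ContinuousOn.integrableOn_compact hK
      fun x hx => (hw x (hKΩ hx)).continuousAt.continuousWithinAt
  have hi' : Integrable (K.indicator (pderiv' w j)) := by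
    rw [integrable_indicator_iff hK.measurableSet]
    exact hw'.integrableOn_compact hK
  have := integral_bilinear_hasLineDerivAt_right_eq_neg_left_of_integrable (μ := volume)
    (f := fun _ : Fin d → ℝ => (1 : ℝ)) (f' := fun _ => 0) (g := K.indicator w)
    (g' := K.indicator (pderiv' w j)) (v := Pi.single j 1) (B := ContinuousLinearMap.mul ℝ ℝ)
    (by simp) (by simpa using hi') (by simpa using hi)
    (fun x _ => by simpa using (hasFDerivAt_const (1 : ℝ) x).hasLineDerivAt (Pi.single j 1))
    (fun x _ => hd x)
  simpa [integral_indicator hK.measurableSet] using this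

/-- A set of reals whose points are all isolated is countable. -/
lemma countable_of_forall_eventually_notMem {S : Set ℝ}
    (h : ∀ r ∈ S, ∀ᶠ q in 𝓝[≠] r, q ∉ S) : S.Countable := by
  have : DiscreteTopology S := by
    rw [discreteTopology_subtype_iff]
    intro r hr
    rw [← disjoint_iff, disjoint_principal_right]
    exact h r hr
  exact Set.countable_coe_iff.1 (TopologicalSpace.separableSpace_iff_countable.1 inferInstance)

/-- Almost everywhere on its zero set, a function has vanishing spatial derivative. -/
lemma ae_pderiv'_eq_zero_of_eq_zero {d : ℕ} {Q : Set ((Fin d → ℝ) × ℝ)} (hQ : IsOpen Q)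
    {u : (Fin d → ℝ) → ℝ → ℝ} (j : Fin d)
    (hu : ContinuousOn (fun p : (Fin d → ℝ) × ℝ => u p.1 p.2) Q)
    (hd : ∀ p ∈ Q, DifferentiableAt ℝ (fun y => u y p.2) p.1)
    (hu' : ContinuousOn (fun p : (Fin d → ℝ) × ℝ => pderiv' (fun y => u y p.2) j p.1) Q) :
    ∀ᵐ p : (Fin d → ℝ) × ℝ, p ∈ Q → u p.1 p.2 = 0 → pderiv' (fun y => u y p.2) j p.1 = 0 := by
  let S : Set ((Fin d → ℝ) × ℝ) :=
    (Q ∩ (fun p => pderiv' (fun y => u y p.2) j p.1) ⁻¹' {0}ᶜ) \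
      (Q ∩ (fun p : (Fin d → ℝ) × ℝ => u p.1 p.2) ⁻¹' {0}ᶜ)
  have hS : MeasurableSet S :=
    (hu'.isOpen_inter_preimage hQ isOpen_compl_singleton).measurableSet.diff
    (hu.isOpen_inter_preimage hQ isOpen_compl_singleton).measurableSet
  have hmem (p) : p ∈ S ↔ p ∈ Q ∧ u p.1 p.2 = 0 ∧ pderiv' (fun y => u y p.2) j p.1 ≠ 0 := by
    simp only [S, Set.mem_sdiff, mem_inter_iff, mem_preimage, mem_compl_iff, mem_singleton_iff]
    tauto
  let L : ℝ →ₗ[ℝ] (Fin d → ℝ) × ℝ :=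
    (LinearMap.toSpanSingleton ℝ ((Fin d → ℝ) × ℝ) (Pi.single j 1, 0))
  have key : ∀ᵐ p ∂((volume : Measure (Fin d → ℝ)).prod (volume : Measure ℝ)), p ∈ Sᶜ := by
    refine ae_mem_of_ae_add_linearMap_mem L volume _ hS.compl fun y => ?_
    have hc : {r : ℝ | y + L r ∈ S}.Countable := by
      refine countable_of_forall_eventually_notMem fun r hr => ?_
      obtain ⟨h1, -, h3⟩ := (hmem _).1 hr
      have hline : HasDerivAt (fun q : ℝ => y.1 + q • (Pi.single j 1 : Fin d → ℝ))
          (Pi.single j 1) r := by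
        simpa using ((hasDerivAt_id r).smul_const (Pi.single j 1 : Fin d → ℝ)).const_add y.1
      have hder : HasDerivAt (fun q : ℝ => u (y + L q).1 (y + L q).2)
          (pderiv' (fun z => u z (y + L r).2) j (y + L r).1) r := by
        have := (hd _ h1).hasFDerivAt.comp_hasDerivAt
          (f := fun q : ℝ => y.1 + q • (Pi.single j 1 : Fin d → ℝ)) r hline
        simpa [L, pderiv', Function.comp_def] using this
      filter_upwards [hder.eventually_ne h3 (c := 0)] with q hq hqS
      exact hq ((hmem _).1 hqS).2.1
    rw [ae_iff]
    simpa using hc.measure_zero volume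
  rw [Measure.volume_eq_prod]
  filter_upwards [key] with p hp hpQ h0
  by_contra h1
  exact hp ((hmem p).2 ⟨hpQ, h0, h1⟩)
/-- The set of points of `closure Ω` at which `|u|` reaches `η` at some time in `[0, T]`. -/
def superlevelProj {d : ℕ} (Ω : Set (Fin d → ℝ)) (T : ℝ) (u : (Fin d → ℝ) → ℝ → ℝ) (η : ℝ) :
    Set (Fin d → ℝ) :=
  Prod.fst '' ((closure Ω ×ˢ Icc 0 T) ∩ (fun p : (Fin d → ℝ) × ℝ => |u p.1 p.2|) ⁻¹' Ici η)

lemma abs_lt_of_notMem_superlevelProj {d : ℕ} {Ω : Set (Fin d → ℝ)} {T : ℝ}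
    {u : (Fin d → ℝ) → ℝ → ℝ} {η : ℝ} {x : Fin d → ℝ} (hx : x ∈ Ω)
    (hxK : x ∉ superlevelProj Ω T u η) {t : ℝ} (ht : t ∈ Icc 0 T) : |u x t| < η := by
  by_contra! h
  exact hxK ⟨(x, t), ⟨⟨subset_closure hx, ht⟩, h⟩, rfl⟩

namespace IsClassicalSolution

variable {d : ℕ} {Ω : Set (Fin d → ℝ)} {T ε δ : ℝ} {f : Fin d → ℝ → ℝ} {B : ℝ → ℝ}
  {u₀ : (Fin d → ℝ) → ℝ} {u : (Fin d → ℝ) → ℝ → ℝ}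

lemma isCompact_superlevelProj (hu : IsClassicalSolution Ω T ε δ f B u₀ u)
    (hΩ : Bornology.IsBounded Ω) (η : ℝ) : IsCompact (superlevelProj Ω T u η) := by
  have hc : IsCompact (closure Ω ×ˢ Icc (0 : ℝ) T) := hΩ.isCompact_closure.prod isCompact_Icc
  refine IsCompact.image ?_ continuous_fst
  exact hc.of_isClosed_subset (hu.cont.abs.preimage_isClosed_of_isClosed hc.isClosed isClosed_Ici)
    inter_subset_left

lemma eq_zero_of_mem_frontier (hu : IsClassicalSolution Ω T ε δ f B u₀ u) (hT : 0 < T)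
    {x : Fin d → ℝ} (hx : x ∈ frontier Ω) {t : ℝ} (ht : t ∈ Icc 0 T) : u x t = 0 := by
  have hc : ContinuousOn (u x) (Icc 0 T) :=
    hu.cont.comp (f := fun s => (x, s)) (by fun_prop) fun s hs =>
      ⟨frontier_subset_closure hx, hs⟩
  have hs : EqOn (u x) (fun _ => 0) (Ioo 0 T) := fun s hs => hu.bc x hx s hs
  exact hs.of_subset_closure hc continuousOn_const Ioo_subset_Icc_self
    (closure_Ioo hT.ne).ge ht

lemma superlevelProj_subset (hu : IsClassicalSolution Ω T ε δ f B u₀ u) (hT : 0 < T)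
    (hΩ : IsOpen Ω) {η : ℝ} (hη : 0 < η) : superlevelProj Ω T u η ⊆ Ω := by
  rintro _ ⟨⟨x, t⟩, ⟨⟨hx, ht⟩, h⟩, rfl⟩
  by_contra hxΩ
  have := hu.eq_zero_of_mem_frontier hT (x := x) (by rw [hΩ.frontier_eq]; exact ⟨hx, hxΩ⟩) ht
  simp only [mem_preimage, this, abs_zero, mem_Ici] at h
  linarith

lemma hasFDerivAt (hu : IsClassicalSolution Ω T ε δ f B u₀ u) {x : Fin d → ℝ} (hx : x ∈ Ω)
    {t : ℝ} (ht : t ∈ Ioo 0 T) :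
    HasFDerivAt (fun y => u y t) (fderiv ℝ (fun y => u y t) x) x :=
  (hu.diff_x x hx t ht).hasFDerivAt

lemma pderiv'_comp (hu : IsClassicalSolution Ω T ε δ f B u₀ u) {h : ℝ → ℝ}
    (hh : Differentiable ℝ h) (j : Fin d) {x : Fin d → ℝ} (hx : x ∈ Ω) {t : ℝ}
    (ht : t ∈ Ioo 0 T) :
    pderiv' (fun y => h (u y t)) j x = deriv h (u x t) * pderiv' (fun z => u z t) j x := by
  have := (hh (u x t)).hasDerivAt.comp_hasFDerivAt x (hu.hasFDerivAt hx ht)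
  rw [pderiv', show (fun y => h (u y t)) = h ∘ fun y => u y t from rfl, this.fderiv]
  simp [pderiv']

lemma hasFDerivAt_flux (hu : IsClassicalSolution Ω T ε δ f B u₀ u) (hB : ContDiff ℝ 1 B)
    (j : Fin d) {x : Fin d → ℝ} (hx : x ∈ Ω) {t : ℝ} (ht : t ∈ Ioo 0 T) :
    HasFDerivAt (fun y => (B (u y t) + δ) * pderiv' (fun z => u z t) j y)
      ((B (u x t) + δ) • fderiv ℝ (pderiv' (fun z => u z t) j) x +
        pderiv' (fun z => u z t) j x • deriv B (u x t) • fderiv ℝ (fun y => u y t) x) x := by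
  have h1 : HasFDerivAt (fun y => B (u y t) + δ)
      (deriv B (u x t) • fderiv ℝ (fun y => u y t) x) x :=
    (((hB.differentiable one_ne_zero (u x t)).hasDerivAt).comp_hasFDerivAt x
      (hu.hasFDerivAt hx ht)).add_const δ
  exact h1.mul (hu.diff_xx j x hx t ht).hasFDerivAt

lemma pderiv'_flux (hu : IsClassicalSolution Ω T ε δ f B u₀ u) (hB : ContDiff ℝ 1 B)
    (j : Fin d) {x : Fin d → ℝ} (hx : x ∈ Ω) {t : ℝ} (ht : t ∈ Ioo 0 T) :
    pderiv' (fun y => (B (u y t) + δ) * pderiv' (fun z => u z t) j y) j x =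
      (B (u x t) + δ) * pderiv' (pderiv' (fun z => u z t) j) j x +
        deriv B (u x t) * pderiv' (fun z => u z t) j x ^ 2 := by
  rw [pderiv', (hu.hasFDerivAt_flux hB j hx ht).fderiv]
  simp [pderiv']
  ring

lemma continuousOn_slice {K : Set (Fin d → ℝ)} (hK : K ⊆ Ω) {t : ℝ} (ht : t ∈ Ioo 0 T)
    {F : (Fin d → ℝ) × ℝ → ℝ} (hF : ContinuousOn F (Ω ×ˢ Ioo 0 T)) :
    ContinuousOn (fun x => F (x, t)) K :=
  hF.comp (f := fun x => (x, t)) (by fun_prop) fun _ hx => ⟨hK hx, ht⟩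

lemma continuousOn_interior (hu : IsClassicalSolution Ω T ε δ f B u₀ u) :
    ContinuousOn (fun p : (Fin d → ℝ) × ℝ => u p.1 p.2) (Ω ×ˢ Ioo 0 T) :=
  hu.cont.mono (prod_mono subset_closure Ioo_subset_Icc_self)

/-- The divergence obtained by multiplying the spatial part of the equation by `g u`. -/
lemma pderiv'_truncated_flux (hu : IsClassicalSolution Ω T ε δ f B u₀ u) (hB : ContDiff ℝ 1 B)
    (hf : ∀ j, ContDiff ℝ 2 (f j)) {θ g : ℝ → ℝ} (hg : ∀ s, HasDerivAt g (θ s) s)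
    {Q : Fin d → ℝ → ℝ} (hQ : ∀ j s, HasDerivAt (Q j) (g s * deriv (f j) s) s)
    (j : Fin d) {x : Fin d → ℝ} (hx : x ∈ Ω) {t : ℝ} (ht : t ∈ Ioo 0 T) :
    DifferentiableAt ℝ (fun y => ε * (g (u y t) *
      ((B (u y t) + δ) * pderiv' (fun z => u z t) j y)) - Q j (u y t)) x ∧
    pderiv' (fun y => ε * (g (u y t) *
      ((B (u y t) + δ) * pderiv' (fun z => u z t) j y)) - Q j (u y t)) j x =
    ε * (θ (u x t) * (B (u x t) + δ) * pderiv' (fun z => u z t) j x ^ 2) +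
    g (u x t) * (ε * pderiv' (fun y => (B (u y t) + δ) * pderiv' (fun z => u z t) j y) j x -
      pderiv' (fun y => f j (u y t)) j x) := by
  have hU := hu.hasFDerivAt hx ht
  have hgU := (hg (u x t)).comp_hasFDerivAt x hU
  have hQU := (hQ j (u x t)).comp_hasFDerivAt x hU
  have hΦ := (hu.hasFDerivAt_flux hB j hx ht).differentiableAt.hasFDerivAt
  have hw := ((hgU.mul hΦ).const_mul ε).sub hQU
  refine ⟨hw.differentiableAt, ?_⟩
  rw [hu.pderiv'_comp ((hf j).differentiable two_ne_zero) j hx ht]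
  refine (congrArg (fun L : (Fin d → ℝ) →L[ℝ] ℝ => L (Pi.single j 1)) hw.fderiv).trans ?_
  simp only [pderiv', sub_apply, add_apply, smul_apply, smul_eq_mul, Function.comp_apply]
  ring

/-- The density of the dissipation, truncated by the weight `θ u`. -/
def dissipation (u : (Fin d → ℝ) → ℝ → ℝ) (B θ : ℝ → ℝ) (δ : ℝ) (p : (Fin d → ℝ) × ℝ) : ℝ :=
  ∑ j, θ (u p.1 p.2) * (B (u p.1 p.2) + δ) * pderiv' (fun y => u y p.2) j p.1 ^ 2

lemma continuousOn_dissipation (hu : IsClassicalSolution Ω T ε δ f B u₀ u) (hB : Continuous B)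
    {θ : ℝ → ℝ} (hθ : Continuous θ) :
    ContinuousOn (dissipation u B θ δ) (Ω ×ˢ Ioo 0 T) := by
  refine continuousOn_finsetSum _ fun j _ => ?_
  have h1 := hθ.comp_continuousOn hu.continuousOn_interior
  have h2 := hB.comp_continuousOn hu.continuousOn_interior
  exact (h1.mul (h2.add continuousOn_const)).mul ((hu.cont_dx j).pow 2)

/-- The equation tested against `g u`, where `g` vanishes on `[-η, η]`. -/
lemma setIntegral_add_dissipation (hu : IsClassicalSolution Ω T ε δ f B u₀ u)
    (hΩ : IsOpen Ω) (hΩb : Bornology.IsBounded Ω) (hT : 0 < T) (hB : ContDiff ℝ 1 B)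
    (hf : ∀ j, ContDiff ℝ 2 (f j)) {η : ℝ} (hη : 0 < η) {θ g : ℝ → ℝ} (hθ : Continuous θ)
    (hg : ∀ s, HasDerivAt g (θ s) s) (hg0 : ∀ s, |s| ≤ η → g s = 0) {t : ℝ} (ht : t ∈ Ioo 0 T) :
    ∫ x in superlevelProj Ω T u η, g (u x t) * deriv (u x) t =
      -(ε * ∫ x in superlevelProj Ω T u η, dissipation u B θ δ (x, t)) := by
  set K := superlevelProj Ω T u η
  have hK : IsCompact K := hu.isCompact_superlevelProj hΩb η
  have hKΩ : K ⊆ Ω := hu.superlevelProj_subset hT hΩ hη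
  have hgc : Continuous g := continuous_iff_continuousAt.2 fun s => (hg s).continuousAt
  have hfc (j : Fin d) : Continuous (deriv (f j)) := (hf j).continuous_deriv one_le_two
  let Q : Fin d → ℝ → ℝ := fun j s => ∫ r in (0 : ℝ)..s, g r * deriv (f j) r
  have hQ (j : Fin d) (s : ℝ) : HasDerivAt (Q j) (g s * deriv (f j) s) s :=
    hasDerivAt_primitive (hgc.mul (hfc j)) s
  have hQ0 (j : Fin d) (s : ℝ) (hs : |s| ≤ η) : Q j s = 0 :=
    primitive_eq_zero_of_abs_le (fun q hq => by simp [hg0 q hq]) hs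
  let w : Fin d → (Fin d → ℝ) → ℝ := fun j y => ε * (g (u y t) *
      ((B (u y t) + δ) * pderiv' (fun z => u z t) j y)) - Q j (u y t)
  have hw (j : Fin d) (x) (hx : x ∈ Ω) := hu.pderiv'_truncated_flux hB hf hg hQ j hx ht
  have hUc : ContinuousOn (fun x => u x t) K := continuousOn_slice hKΩ ht hu.continuousOn_interior
  have hdx (j : Fin d) : ContinuousOn (fun x => pderiv' (fun y => u y t) j x) K :=
    continuousOn_slice hKΩ ht (hu.cont_dx j)
  have hdxx (j : Fin d) : ContinuousOn (fun x => pderiv' (pderiv' (fun y => u y t) j) j x) K :=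
    continuousOn_slice hKΩ ht (hu.cont_dxx j j)
  have hw' (j : Fin d) : ContinuousOn (pderiv' (w j) j) K := by
    have hBc := hB.continuous.comp_continuousOn hUc
    have hB'c := (hB.continuous_deriv le_rfl).comp_continuousOn hUc
    have hθc := hθ.comp_continuousOn hUc
    have hgUc := hgc.comp_continuousOn hUc
    have hfUc := (hfc j).comp_continuousOn hUc
    refine ContinuousOn.congr (f := fun x =>
      ε * (θ (u x t) * (B (u x t) + δ) * pderiv' (fun z => u z t) j x ^ 2) +
      g (u x t) * (ε * ((B (u x t) + δ) * pderiv' (pderiv' (fun z => u z t) j) j x +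
        deriv B (u x t) * pderiv' (fun z => u z t) j x ^ 2) -
        deriv (f j) (u x t) * pderiv' (fun z => u z t) j x)) ?_ fun x hx => ?_
    · exact (continuousOn_const.mul ((hθc.mul (hBc.add continuousOn_const)).mul
        ((hdx j).pow 2))).add (hgUc.mul ((continuousOn_const.mul
        (((hBc.add continuousOn_const).mul (hdxx j)).add (hB'c.mul ((hdx j).pow 2)))).sub
        (hfUc.mul (hdx j))))
    · rw [(hw j x (hKΩ hx)).2, hu.pderiv'_flux hB j (hKΩ hx) ht,
        hu.pderiv'_comp ((hf j).differentiable two_ne_zero) j (hKΩ hx) ht]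
  have hzero (j : Fin d) : ∫ x in K, pderiv' (w j) j x = 0 :=
    setIntegral_pderiv'_eq_zero hΩ hK hKΩ j (fun x hx => (hw j x hx).1) (hw' j) fun x hx hxK => by
      have := (abs_lt_of_notMem_superlevelProj hx hxK (Ioo_subset_Icc_self ht)).le
      simp [w, hg0 _ this, hQ0 j _ this]
  have hsum : ∀ x ∈ K, ∑ j, pderiv' (w j) j x =
      ε * dissipation u B θ δ (x, t) + g (u x t) * deriv (u x) t := by
    intro x hx
    have hpde := hu.pde x (hKΩ hx) t ht
    rw [Finset.sum_congr rfl fun j _ => (hw j x (hKΩ hx)).2]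
    simp only [dissipation, Finset.sum_add_distrib, Finset.sum_sub_distrib, ← Finset.mul_sum]
    rw [← hpde]
    ring
  have hD : IntegrableOn (fun x => ε * dissipation u B θ δ (x, t)) K :=
    (continuousOn_const.mul (continuousOn_slice hKΩ ht
      (hu.continuousOn_dissipation hB.continuous hθ))).integrableOn_compact hK
  have hE : IntegrableOn (fun x => g (u x t) * deriv (u x) t) K :=
    ((hgc.comp_continuousOn hUc).mul
      (continuousOn_slice hKΩ ht hu.cont_dt)).integrableOn_compact hK
  have htot : ∫ x in K, ∑ j, pderiv' (w j) j x = 0 := by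
    rw [integral_finsetSum _ fun j _ => (hw' j).integrableOn_compact hK]
    simp [hzero]
  rw [setIntegral_congr_fun hK.measurableSet hsum, integral_add hD hE,
    integral_const_mul] at htot
  linarith

/-- Integrated in time, the truncated dissipation is controlled by the initial energy. -/
lemma setIntegral_dissipation_le (hu : IsClassicalSolution Ω T ε δ f B u₀ u)
    (hΩ : IsOpen Ω) (hΩb : Bornology.IsBounded Ω) (hB : ContDiff ℝ 1 B)
    (hf : ∀ j, ContDiff ℝ 2 (f j)) {η : ℝ} (hη : 0 < η) {θ g G : ℝ → ℝ} (hθ : Continuous θ)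
    (hg : ∀ s, HasDerivAt g (θ s) s) (hG : ∀ s, HasDerivAt G (g s) s)
    (hg0 : ∀ s, |s| ≤ η → g s = 0) (hG0 : ∀ s, 0 ≤ G s) {a b : ℝ} (ha : 0 < a) (hab : a ≤ b)
    (hb : b < T) :
    ε * ∫ p in superlevelProj Ω T u η ×ˢ Icc a b, dissipation u B θ δ p ≤
      ∫ x in superlevelProj Ω T u η, G (u x a) := by
  have hT : 0 < T := ha.trans_le hab |>.trans hb
  set K := superlevelProj Ω T u η
  have hK : IsCompact K := hu.isCompact_superlevelProj hΩb η
  have hKΩ : K ⊆ Ω := hu.superlevelProj_subset hT hΩ hη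
  have hgc : Continuous g := continuous_iff_continuousAt.2 fun s => (hg s).continuousAt
  have hGc : Continuous G := continuous_iff_continuousAt.2 fun s => (hG s).continuousAt
  have hI : Icc a b ⊆ Ioo 0 T := fun t ht => ⟨ha.trans_le ht.1, ht.2.trans_lt hb⟩
  have hKI : K ×ˢ Icc a b ⊆ Ω ×ˢ Ioo 0 T := prod_mono hKΩ hI
  have hKIc : IsCompact (K ×ˢ Icc a b) := hK.prod isCompact_Icc
  have hEi : IntegrableOn (fun p : (Fin d → ℝ) × ℝ => g (u p.1 p.2) * deriv (u p.1) p.2)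
      (K ×ˢ Icc a b) (volume.prod volume) :=
    (((hgc.comp_continuousOn hu.continuousOn_interior).mul hu.cont_dt).mono
      hKI).integrableOn_compact hKIc
  have hDi : IntegrableOn (dissipation u B θ δ) (K ×ˢ Icc a b) (volume.prod volume) :=
    ((hu.continuousOn_dissipation hB.continuous hθ).mono hKI).integrableOn_compact hKIc
  have hGi (t : ℝ) (ht : t ∈ Ioo 0 T) : IntegrableOn (fun x => G (u x t)) K :=
    (hGc.comp_continuousOn
      (continuousOn_slice hKΩ ht hu.continuousOn_interior)).integrableOn_compact hK
  have hftc : ∀ x ∈ K, ∫ t in Icc a b, g (u x t) * deriv (u x) t = G (u x b) - G (u x a) := by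
    intro x hx
    rw [integral_Icc_eq_integral_Ioc, ← intervalIntegral.integral_of_le hab]
    refine intervalIntegral.integral_eq_sub_of_hasDerivAt (f := fun t => G (u x t))
      (fun t ht => ?_) (ContinuousOn.intervalIntegrable ?_)
    · rw [uIcc_of_le hab] at ht
      exact (hG (u x t)).comp t (hu.diff_t x (hKΩ hx) t (hI ht)).hasDerivAt
    · rw [uIcc_of_le hab]
      exact ((hgc.comp_continuousOn hu.continuousOn_interior).mul hu.cont_dt).comp
        (f := fun t => (x, t)) (by fun_prop) fun t ht => ⟨hKΩ hx, hI ht⟩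
  have hleft : ∫ p in K ×ˢ Icc a b, g (u p.1 p.2) * deriv (u p.1) p.2 =
      (∫ x in K, G (u x b)) - ∫ x in K, G (u x a) := by
    rw [Measure.volume_eq_prod, setIntegral_prod _ hEi,
      setIntegral_congr_fun hK.measurableSet hftc,
      integral_sub (hGi b (hI ⟨hab, le_rfl⟩)) (hGi a (hI ⟨le_rfl, hab⟩))]
  have hswap {F : (Fin d → ℝ) × ℝ → ℝ} (hF : IntegrableOn F (K ×ˢ Icc a b) (volume.prod volume)) :
      ∫ p in K ×ˢ Icc a b, F p = ∫ t in Icc a b, ∫ x in K, F (x, t) := by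
    rw [Measure.volume_eq_prod, setIntegral_prod _ hF]
    refine integral_integral_swap (f := fun x t => F (x, t)) ?_
    rwa [Measure.prod_restrict]
  have hright : ∫ p in K ×ˢ Icc a b, g (u p.1 p.2) * deriv (u p.1) p.2 =
      -(ε * ∫ p in K ×ˢ Icc a b, dissipation u B θ δ p) := by
    rw [hswap hEi, hswap hDi, ← integral_const_mul, ← integral_neg]
    exact setIntegral_congr_fun measurableSet_Icc fun t ht =>
      hu.setIntegral_add_dissipation hΩ hΩb hT hB hf hη hθ hg hg0 (hI ht)
  have : 0 ≤ ∫ x in K, G (u x b) := integral_nonneg fun x => hG0 _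
  linarith

lemma integrableOn_sq (hu : IsClassicalSolution Ω T ε δ f B u₀ u) (hΩb : Bornology.IsBounded Ω)
    {t : ℝ} (ht : t ∈ Icc 0 T) : IntegrableOn (fun x => u x t ^ 2 / 2) Ω := by
  have hc : ContinuousOn (fun x => u x t) (closure Ω) :=
    hu.cont.comp (f := fun x => (x, t)) (by fun_prop) fun x hx => ⟨hx, ht⟩
  exact (((hc.pow 2).div_const 2).integrableOn_compact hΩb.isCompact_closure).mono_set
    subset_closure

lemma tendsto_energy (hu : IsClassicalSolution Ω T ε δ f B u₀ u) (hΩ : IsOpen Ω)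
    (hΩb : Bornology.IsBounded Ω) (hT : 0 < T) :
    Tendsto (fun t => ∫ x in Ω, u x t ^ 2 / 2) (𝓝[Icc 0 T] 0)
      (𝓝 (∫ x in Ω, u₀ x ^ 2 / 2)) := by
  have h0 : (0 : ℝ) ∈ Icc 0 T := ⟨le_rfl, hT.le⟩
  obtain ⟨C, hC⟩ := (hΩb.isCompact_closure.prod (isCompact_Icc (a := (0 : ℝ)) (b := T)))
    |>.exists_bound_of_continuousOn ((hu.cont.pow 2).div_const 2)
  have hvol : volume Ω < ⊤ := hΩb.measure_lt_top
  rw [← setIntegral_congr_fun hΩ.measurableSet (f := fun x => u x 0 ^ 2 / 2)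
    fun x hx => by simp only [hu.ic x hx]]
  refine tendsto_integral_filter_of_dominated_convergence (fun _ => C) ?_ ?_
    (integrableOn_const hvol.ne) ?_
  · filter_upwards [self_mem_nhdsWithin] with t ht
    exact (hu.integrableOn_sq hΩb ht).aestronglyMeasurable
  · filter_upwards [self_mem_nhdsWithin] with t ht
    filter_upwards [ae_restrict_mem hΩ.measurableSet] with x hx
    exact hC (x, t) ⟨subset_closure hx, ht⟩
  · filter_upwards [ae_restrict_mem hΩ.measurableSet] with x hx
    have hc : ContinuousOn (u x) (Icc 0 T) :=
      hu.cont.comp (f := fun s => (x, s)) (by fun_prop) fun s hs => ⟨subset_closure hx, hs⟩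
    exact (((hc 0 h0).pow 2).div_const 2).tendsto

lemma dissipation_nonneg (u : (Fin d → ℝ) → ℝ → ℝ) {θ : ℝ → ℝ} (hB : ∀ y, 0 ≤ B y)
    (hθ : ∀ s, 0 ≤ θ s) (hδ : 0 ≤ δ) (p : (Fin d → ℝ) × ℝ) : 0 ≤ dissipation u B θ δ p :=
  Finset.sum_nonneg fun _ _ =>
    mul_nonneg (mul_nonneg (hθ _) (add_nonneg (hB _) hδ)) (sq_nonneg _)

/-- The energy inequality, with the dissipation as a lower Lebesgue integral. -/
lemma lintegral_dissipation_le (hu : IsClassicalSolution Ω T ε δ f B u₀ u) (hΩ : IsOpen Ω)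
    (hΩb : Bornology.IsBounded Ω) (hT : 0 < T) (hε : 0 < ε) (hδ : 0 ≤ δ) (hB : ContDiff ℝ 1 B)
    (hB0 : ∀ y, 0 ≤ B y) (hf : ∀ j, ContDiff ℝ 2 (f j)) :
    ∫⁻ p in Ω ×ˢ Ioo 0 T, ENNReal.ofReal (dissipation u B (fun _ => 1) 0 p) ≤
      ENNReal.ofReal ((∫ x in Ω, u₀ x ^ 2 / 2) / ε) := by
  let η : ℕ → ℝ := fun n => 1 / ((n : ℝ) + 1)
  let a : ℕ → ℝ := fun n => T / ((n : ℝ) + 2)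
  have hη (n) : 0 < η n := Nat.one_div_pos_of_nat
  have ha (n) : 0 < a n := by positivity
  have haT (n) : a n ≤ T - a n := by
    have : a n ≤ T / 2 := by
      refine div_le_div_of_nonneg_left hT.le two_pos ?_
      linarith [n.cast_nonneg (α := ℝ)]
    linarith
  have hη0 : Tendsto η atTop (𝓝 0) := tendsto_one_div_add_atTop_nhds_zero_nat
  have ha0 : Tendsto a atTop (𝓝 0) :=
    tendsto_const_nhds.div_atTop (tendsto_atTop_add_const_right _ _ tendsto_natCast_atTop_atTop)
  choose θ g G hθ hg hG hθ0 hθ1 hg0 hG0 hGle using fun n => exists_truncation (hη n)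
  let K : ℕ → Set (Fin d → ℝ) := fun n => superlevelProj Ω T u (η n)
  have hK (n) : IsCompact (K n) := hu.isCompact_superlevelProj hΩb _
  have hKΩ (n) : K n ⊆ Ω := hu.superlevelProj_subset hT hΩ (hη n)
  let R : ℕ → Set ((Fin d → ℝ) × ℝ) := fun n => K n ×ˢ Icc (a n) (T - a n)
  have hR (n) : IsCompact (R n) := (hK n).prod isCompact_Icc
  have hRΩ (n) : R n ⊆ Ω ×ˢ Ioo 0 T :=
    prod_mono (hKΩ n) fun t ht => ⟨(ha n).trans_le ht.1, ht.2.trans_lt (by linarith [ha n])⟩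
  have hDc (n) : ContinuousOn (dissipation u B (θ n) δ) (R n) :=
    (hu.continuousOn_dissipation hB.continuous (hθ n)).mono (hRΩ n)
  let F : ℕ → (Fin d → ℝ) × ℝ → ENNReal := fun n =>
    (R n).indicator fun p => ENNReal.ofReal (dissipation u B (θ n) δ p)
  have hF (n) : AEMeasurable (F n) (volume.restrict (Ω ×ˢ Ioo 0 T)) := by
    rw [aemeasurable_indicator_iff (hR n).measurableSet,
      Measure.restrict_restrict_of_subset (hRΩ n)]
    exact ((hDc n).aemeasurable (hR n).measurableSet).ennreal_ofReal
  have hFle (n) : ∫⁻ p in Ω ×ˢ Ioo 0 T, F n p ≤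
      ENNReal.ofReal ((∫ x in Ω, u x (a n) ^ 2 / 2) / ε) := by
    have haI : a n ∈ Icc 0 T := ⟨(ha n).le, by linarith [haT n, ha n]⟩
    rw [lintegral_indicator (hR n).measurableSet, Measure.restrict_restrict_of_subset (hRΩ n),
      ← ofReal_integral_eq_lintegral_ofReal ((hDc n).integrableOn_compact (hR n))
        (.of_forall (dissipation_nonneg u hB0 (hθ0 n) hδ))]
    refine ENNReal.ofReal_le_ofReal ?_
    rw [le_div_iff₀' hε]
    refine (hu.setIntegral_dissipation_le hΩ hΩb hB hf (hη n) (hθ n) (hg n) (hG n) (hg0 n) (hG0 n)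
      (ha n) (haT n) (by linarith [ha n])).trans ?_
    have hsq := hu.integrableOn_sq hΩb haI
    refine (integral_mono_of_nonneg (.of_forall fun x => hG0 n _) (hsq.mono_set (hKΩ n))
      (.of_forall fun x => hGle n _)).trans ?_
    exact setIntegral_mono_set hsq (.of_forall fun x => by positivity)
      (LE.le.eventuallyLE (hKΩ n))
  have hae : ∀ᵐ p ∂(volume.restrict (Ω ×ˢ Ioo 0 T)),
      ENNReal.ofReal (dissipation u B (fun _ => 1) 0 p) ≤ liminf (fun n => F n p) atTop := by
    have hQ : IsOpen (Ω ×ˢ Ioo 0 T) := hΩ.prod isOpen_Ioo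
    have hnull : ∀ᵐ p : (Fin d → ℝ) × ℝ, ∀ j, p ∈ Ω ×ˢ Ioo 0 T → u p.1 p.2 = 0 →
        pderiv' (fun y => u y p.2) j p.1 = 0 :=
      ae_all_iff.2 fun j => ae_pderiv'_eq_zero_of_eq_zero hQ j hu.continuousOn_interior
        (fun p hp => hu.diff_x p.1 hp.1 p.2 hp.2) (hu.cont_dx j)
    filter_upwards [ae_restrict_of_ae hnull, ae_restrict_mem hQ.measurableSet] with p hp hpQ
    obtain h0 | h0 := eq_or_ne (u p.1 p.2) 0
    · simp [dissipation, hp _ hpQ h0]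
    · refine le_liminf_of_le (by isBoundedDefault) ?_
      have h2η : Tendsto (fun n => 2 * η n) atTop (𝓝 0) := by simpa using hη0.const_mul 2
      filter_upwards [h2η.eventually_le_const (abs_pos.2 h0), ha0.eventually_le_const hpQ.2.1,
        ha0.eventually_le_const (sub_pos.2 hpQ.2.2)] with n hn hn1 hn2
      have hpR : p ∈ R n := by
        refine ⟨⟨p, ⟨⟨subset_closure hpQ.1, Ioo_subset_Icc_self hpQ.2⟩, ?_⟩, rfl⟩, hn1, ?_⟩
        · exact (by linarith [hη n] : η n ≤ 2 * η n).trans hn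
        · linarith
      simp only [F, indicator_of_mem hpR]
      refine ENNReal.ofReal_le_ofReal (Finset.sum_le_sum fun j _ => ?_)
      rw [hθ1 n _ hn]
      gcongr
  have hlim : Tendsto (fun n => ENNReal.ofReal ((∫ x in Ω, u x (a n) ^ 2 / 2) / ε)) atTop
      (𝓝 (ENNReal.ofReal ((∫ x in Ω, u₀ x ^ 2 / 2) / ε))) := by
    refine ENNReal.tendsto_ofReal (Tendsto.div_const ?_ _)
    refine (hu.tendsto_energy hΩ hΩb hT).comp
      (tendsto_nhdsWithin_iff.2 ⟨ha0, .of_forall fun n => ?_⟩)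
    exact ⟨(ha n).le, by linarith [haT n, ha n]⟩
  calc ∫⁻ p in Ω ×ˢ Ioo 0 T, ENNReal.ofReal (dissipation u B (fun _ => 1) 0 p)
      ≤ ∫⁻ p in Ω ×ˢ Ioo 0 T, liminf (fun n => F n p) atTop := lintegral_mono_ae hae
    _ ≤ liminf (fun n => ∫⁻ p in Ω ×ˢ Ioo 0 T, F n p) atTop := lintegral_liminf_le' hF
    _ ≤ liminf (fun n => ENNReal.ofReal ((∫ x in Ω, u x (a n) ^ 2 / 2) / ε)) atTop :=
        liminf_le_liminf (.of_forall hFle)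
    _ = ENNReal.ofReal ((∫ x in Ω, u₀ x ^ 2 / 2) / ε) := hlim.liminf_eq

end IsClassicalSolution

/-- **Degenerate energy estimate**: for a classical solution of the regularized viscosity
problem with viscosity `B + δ`,
`ε Σⱼ ∫_{Ω_T} B(u)|∂ⱼu|² ≤ (1/2) ∫_Ω u₀² ≤ (1/2) A² vol(Ω)`. -/
theorem energy_estimate_degenerate
    (d : ℕ) (Ω : Set (Fin d → ℝ)) (hΩopen : IsOpen Ω) (hΩbd : Bornology.IsBounded Ω)
    (T ε δ : ℝ) (hT : 0 < T) (hε : 0 < ε) (hδ : 0 < δ)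
    (f : Fin d → ℝ → ℝ) (hf : ∀ j, ContDiff ℝ 2 (f j))
    (hf' : ∀ j, ∃ C, ∀ y : ℝ, |deriv (f j) y| ≤ C)
    (B : ℝ → ℝ) (hB : ContDiff ℝ 1 B) (hBbd : ∃ C, ∀ y : ℝ, |B y| ≤ C)
    (hBnonneg : ∀ y : ℝ, 0 ≤ B y)
    (A : ℝ) (hA : 0 < A)
    (u₀ : (Fin d → ℝ) → ℝ) (hu₀smooth : ContDiff ℝ (⊤ : ℕ∞) u₀)
    (hu₀supp : HasCompactSupport u₀) (hu₀Ω : tsupport u₀ ⊆ Ω)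
    (hu₀A : ∀ x, |u₀ x| ≤ A)
    (u : (Fin d → ℝ) → ℝ → ℝ) (hu : IsClassicalSolution Ω T ε δ f B u₀ u) :
    ε * ∑ j, ∫ p in Ω ×ˢ Set.Ioo 0 T,
        B (u p.1 p.2) * (pderiv' (fun y => u y p.2) j p.1) ^ 2
        ≤ (1 / 2) * ∫ x in Ω, (u₀ x) ^ 2 ∧
    (1 / 2 : ℝ) * ∫ x in Ω, (u₀ x) ^ 2 ≤ (1 / 2) * A ^ 2 * (volume Ω).toReal := by
  refine ⟨?_, ?_⟩
  · have hQ : MeasurableSet (Ω ×ˢ Ioo 0 T) := (hΩopen.prod isOpen_Ioo).measurableSet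
    have hle := hu.lintegral_dissipation_le hΩopen hΩbd hT hε hδ.le hB hBnonneg hf
    have hB2 := hB.continuous.comp_continuousOn hu.continuousOn_interior
    have hjc (j : Fin d) : ContinuousOn (fun p : (Fin d → ℝ) × ℝ =>
        B (u p.1 p.2) * (pderiv' (fun y => u y p.2) j p.1) ^ 2) (Ω ×ˢ Ioo 0 T) :=
      hB2.mul ((hu.cont_dx j).pow 2)
    have hD (p) : IsClassicalSolution.dissipation u B (fun _ => 1) 0 p =
        ∑ j, B (u p.1 p.2) * (pderiv' (fun y => u y p.2) j p.1) ^ 2 := by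
      simp [IsClassicalSolution.dissipation]
    simp_rw [hD] at hle
    have h0 (j : Fin d) (p : (Fin d → ℝ) × ℝ) :
        0 ≤ B (u p.1 p.2) * (pderiv' (fun y => u y p.2) j p.1) ^ 2 :=
      mul_nonneg (hBnonneg _) (sq_nonneg _)
    have hsum0 (p : (Fin d → ℝ) × ℝ) :
        0 ≤ ∑ j, B (u p.1 p.2) * (pderiv' (fun y => u y p.2) j p.1) ^ 2 :=
      Finset.sum_nonneg fun j _ => h0 j p
    have hsumi : IntegrableOn (fun p : (Fin d → ℝ) × ℝ =>
        ∑ j, B (u p.1 p.2) * (pderiv' (fun y => u y p.2) j p.1) ^ 2) (Ω ×ˢ Ioo 0 T) :=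
      (lintegral_ofReal_ne_top_iff_integrable
        ((continuousOn_finsetSum _ fun j _ => hjc j).aestronglyMeasurable hQ)
        (.of_forall hsum0)).1 (hle.trans_lt ENNReal.ofReal_lt_top).ne
    have hji (j : Fin d) : IntegrableOn (fun p : (Fin d → ℝ) × ℝ =>
        B (u p.1 p.2) * (pderiv' (fun y => u y p.2) j p.1) ^ 2) (Ω ×ˢ Ioo 0 T) := by
      refine hsumi.mono' ((hjc j).aestronglyMeasurable hQ) (.of_forall fun p => ?_)
      rw [Real.norm_of_nonneg (h0 j p)]
      exact Finset.single_le_sum (f := fun j => B (u p.1 p.2) *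
        (pderiv' (fun y => u y p.2) j p.1) ^ 2) (fun j _ => h0 j p) (Finset.mem_univ j)
    rw [← integral_finsetSum _ fun j _ => hji j, ← le_div_iff₀' hε]
    rw [← ofReal_integral_eq_lintegral_ofReal hsumi (.of_forall hsum0), integral_div,
      ENNReal.ofReal_le_ofReal_iff (by positivity)] at hle
    exact hle.trans_eq (by ring)
  · have hle : ∫ x in Ω, (u₀ x) ^ 2 ≤ ∫ _ in Ω, A ^ 2 :=
      integral_mono_of_nonneg (.of_forall fun x => sq_nonneg _)
        (integrableOn_const hΩbd.measure_lt_top.ne)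
        (.of_forall fun x => sq_le_sq.2 ((hu₀A x).trans (le_abs_self A)))
    rw [setIntegral_const, smul_eq_mul, Measure.real] at hle
    linarith
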